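/- arXiv:2010.03414 — 2 statements merged into one kernel-verified Lean document; each statement's English description precedes it below -/
import Mathlib

section
/- Let (W,S) be a Coxeter system. The weak right Bruhat order makes W into a complete meet-semilattice: every nonempty subset of W has a greatest lower bound with respect to the weak right order. -/
namespace CoxeterSystem

theorem _root_.Function.End.mul_apply {α : Type*} (f g : Function.End α) (a : α) :
    (f * g) a = f (g a) := rfl

theorem _root_.Function.End.one_apply {α : Type*} (a : α) : (1 : Function.End α) a = a := rfl

variable {B W : Type*} [Group W] {M : CoxeterMatrix B} (cs : CoxeterSystem M W)

/-! ### The action on signed elements and the inversion cocycle -/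

open Classical in
/-- The action of a simple reflection on signed group elements: conjugate, and flip the sign
exactly when the element is that simple reflection. -/
noncomputable def signedConj (i : B) : Function.End (W × ZMod 2) :=
  fun p ↦ (cs.simple i * p.1 * cs.simple i, p.2 + if p.1 = cs.simple i then 1 else 0)

theorem simple_mul_pow_simple_mul_simple (i j : B) (k : ℕ) :
    (cs.simple i * cs.simple j) ^ k * cs.simple j * (cs.simple i * cs.simple j) ^ k =
      cs.simple j := by
  induction k with
  | zero => simp
  | succ k ih =>
    calc _ = (cs.simple i * cs.simple j) ^ k * (cs.simple i * cs.simple j * cs.simple j *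
            (cs.simple i * cs.simple j)) * (cs.simple i * cs.simple j) ^ k := by
          rw [pow_succ]; nth_rewrite 2 [← pow_succ]; rw [pow_succ']; simp only [mul_assoc]
      _ = _ := by simp [ih]

open Classical in
theorem signedConj_mul_pow_apply (i j : B) (k : ℕ) (p : W × ZMod 2) :
    ((cs.signedConj i * cs.signedConj j) ^ k) p =
      ((cs.simple i * cs.simple j) ^ k * p.1 * ((cs.simple i * cs.simple j) ^ k)⁻¹,
        p.2 + ∑ n ∈ Finset.range (2 * k),
          if (cs.simple i * cs.simple j) ^ n * p.1 = cs.simple j then 1 else 0) := by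
  induction k with
  | zero => simp [Function.End.one_apply]
  | succ k ih =>
    have key := cs.simple_mul_pow_simple_mul_simple i j k
    have hij : (cs.simple i * cs.simple j)⁻¹ = cs.simple j * cs.simple i := by simp
    rw [pow_succ' (cs.signedConj i * cs.signedConj j), Function.End.mul_apply,
      ih, Function.End.mul_apply]
    simp only [signedConj]
    refine Prod.ext ?_ ?_
    · simp only
      rw [pow_succ' (cs.simple i * cs.simple j), mul_inv_rev, hij]
      simp only [mul_assoc]
    · simp only
      rw [show 2 * (k + 1) = 2 * k + 1 + 1 by ring, Finset.sum_range_succ, Finset.sum_range_succ,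
        add_assoc, add_assoc, add_assoc]
      set c := cs.simple i * cs.simple j with hc
      have h₁ : c ^ k * p.1 * (c ^ k)⁻¹ = cs.simple j ↔ c ^ (2 * k) * p.1 = cs.simple j := by
        rw [mul_inv_eq_iff_eq_mul, two_mul, pow_add, mul_assoc, ← mul_right_inj (c ^ k),
          ← mul_assoc _ (cs.simple j), key]
      have h₂ : cs.simple j * (c ^ k * p.1 * (c ^ k)⁻¹) * cs.simple j = cs.simple i ↔
          c ^ (2 * k + 1) * p.1 = cs.simple j := by
        have e : cs.simple j * (c ^ k * p.1 * (c ^ k)⁻¹) * cs.simple j = cs.simple i ↔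
            c ^ k * p.1 * (c ^ k)⁻¹ = cs.simple j * c := by
          rw [hc, ← mul_right_inj (cs.simple j), ← mul_left_inj (cs.simple j)]
          simp [mul_assoc]
        rw [e, mul_inv_eq_iff_eq_mul, mul_assoc, ← pow_succ', ← mul_right_inj (c ^ (k + 1)),
          ← mul_assoc _ (cs.simple j), cs.simple_mul_pow_simple_mul_simple i j (k + 1),
          ← mul_assoc, ← pow_add, show k + 1 + k = 2 * k + 1 by ring]
      simp only [h₁, h₂]

open Classical in
theorem isLiftable_signedConj : M.IsLiftable cs.signedConj := by
  intro i j
  have hm := cs.simple_mul_simple_pow i j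
  generalize M.M i j = m at hm ⊢
  funext p
  have hs : ∑ n ∈ Finset.range (2 * m),
      (if (cs.simple i * cs.simple j) ^ n * p.1 = cs.simple j then (1 : ZMod 2) else 0) = 0 := by
    rw [two_mul, Finset.sum_range_add]
    simp only [pow_add, hm, one_mul, CharTwo.add_self_eq_zero]
  rw [signedConj_mul_pow_apply, hm, hs]
  simp [Function.End.one_apply]

/-- The action of a Coxeter group on signed group elements extending `signedConj`. -/
noncomputable def signedAction : W →* Function.End (W × ZMod 2) :=
  cs.lift ⟨cs.signedConj, cs.isLiftable_signedConj⟩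

theorem signedAction_simple (i : B) : cs.signedAction (cs.simple i) = cs.signedConj i :=
  cs.lift_apply_simple _ i

theorem signedAction_apply (w g : W) (a : ZMod 2) :
    cs.signedAction w (g, a) = (w * g * w⁻¹, a + (cs.signedAction w (g, 0)).2) := by
  induction w using cs.simple_induction_left generalizing a with
  | one => simp [Function.End.one_apply]
  | mul_simple_left w i ih =>
    rw [map_mul, Function.End.mul_apply, Function.End.mul_apply, ih, ih 0,
      signedAction_simple]
    simp [signedConj, mul_assoc, add_assoc]

/-- The parity of the number of occurrences of `t` in the left inversion sequence of any
word for `w`. -/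
noncomputable def leftInversionParity (w t : W) : ZMod 2 := (cs.signedAction w⁻¹ (t, 0)).2

theorem leftInversionParity_mul (u v t : W) :
    cs.leftInversionParity (u * v) t =
      cs.leftInversionParity u t + cs.leftInversionParity v (u⁻¹ * t * u) := by
  unfold leftInversionParity
  rw [mul_inv_rev, map_mul, Function.End.mul_apply,
    cs.signedAction_apply u⁻¹ t 0, cs.signedAction_apply v⁻¹]
  simp

theorem leftInversionParity_one (t : W) : cs.leftInversionParity 1 t = 0 := by
  simp [leftInversionParity, Function.End.one_apply]

open Classical in
theorem leftInversionParity_simple (i : B) (t : W) :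
    cs.leftInversionParity (cs.simple i) t = if t = cs.simple i then 1 else 0 := by
  simp [leftInversionParity, signedAction_simple, signedConj]

theorem mem_leftInvSeq_of_leftInversionParity_ne_zero (ω : List B) (t : W)
    (h : cs.leftInversionParity (cs.wordProd ω) t ≠ 0) : t ∈ cs.leftInvSeq ω := by
  induction ω generalizing t with
  | nil => simp [leftInversionParity_one] at h
  | cons i ω ih =>
    rw [wordProd_cons, leftInversionParity_mul, leftInversionParity_simple] at h
    simp only [leftInvSeq, List.mem_cons, List.mem_map]
    by_cases ht : t = cs.simple i
    · exact Or.inl ht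
    · rw [if_neg ht, zero_add] at h
      exact Or.inr ⟨_, ih _ h, by simp [mul_assoc]⟩

theorem IsReflection.leftInversionParity_self {t : W} (ht : cs.IsReflection t) :
    cs.leftInversionParity t t = 1 := by
  obtain ⟨u, i, rfl⟩ := ht
  have h := cs.leftInversionParity_mul u u⁻¹ (u * cs.simple i * u⁻¹)
  rw [mul_inv_cancel, leftInversionParity_one] at h
  have e : u⁻¹ * (u * cs.simple i * u⁻¹) * u = cs.simple i := by group
  rw [e] at h
  have e' : (u * cs.simple i)⁻¹ * (u * cs.simple i * u⁻¹) * (u * cs.simple i) = cs.simple i := by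
    simp [mul_assoc]
  rw [leftInversionParity_mul, leftInversionParity_mul, e, e', leftInversionParity_simple,
    if_pos rfl, add_right_comm, ← h, zero_add]

theorem length_lt_of_leftInversionParity_ne_zero {w t : W}
    (h : cs.leftInversionParity w t ≠ 0) : cs.length (t * w) < cs.length w := by
  obtain ⟨ω, hω, rfl⟩ := cs.exists_isReduced w
  exact (cs.isLeftInversion_of_mem_leftInvSeq hω
    (cs.mem_leftInvSeq_of_leftInversionParity_ne_zero ω t h)).2

theorem IsReflection.leftInversionParity_ne_zero_iff {t : W} (ht : cs.IsReflection t) (w : W) :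
    cs.leftInversionParity w t ≠ 0 ↔ cs.length (t * w) < cs.length w := by
  refine ⟨cs.length_lt_of_leftInversionParity_ne_zero, fun hlt h0 ↦ ?_⟩
  have h : cs.leftInversionParity (t * w) t ≠ 0 := by
    rw [leftInversionParity_mul, ht.leftInversionParity_self, inv_mul_cancel, one_mul, h0]
    simp
  have := cs.length_lt_of_leftInversionParity_ne_zero h
  rw [← mul_assoc, ht.mul_self, one_mul] at this
  omega

/-- A form of the strong exchange property: a left inversion of a product comes from one of the
two factors. -/
theorem IsReflection.length_mul_lt_or {t : W} (ht : cs.IsReflection t) (u v : W)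
    (h : cs.length (t * (u * v)) < cs.length (u * v)) :
    cs.length (t * u) < cs.length u ∨ cs.length (u⁻¹ * t * u * v) < cs.length v := by
  rw [← ht.leftInversionParity_ne_zero_iff, leftInversionParity_mul] at h
  by_cases hu : cs.leftInversionParity u t = 0
  · rw [hu, zero_add] at h
    exact Or.inr (cs.length_lt_of_leftInversionParity_ne_zero h)
  · exact Or.inl (cs.length_lt_of_leftInversionParity_ne_zero hu)

/-- The folding property. -/
theorem simple_mul_eq_mul_simple (b : W) (i j : B)
    (hi : ¬ cs.length (cs.simple i * b) < cs.length b)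
    (h : cs.length (cs.simple i * (b * cs.simple j)) < cs.length (b * cs.simple j)) :
    cs.simple i * b = b * cs.simple j := by
  have hr := cs.isReflection_simple i
  rw [← hr.leftInversionParity_ne_zero_iff, not_ne_iff] at hi
  rw [← hr.leftInversionParity_ne_zero_iff, leftInversionParity_mul, hi, zero_add,
    leftInversionParity_simple] at h
  have e : b⁻¹ * cs.simple i * b = cs.simple j := by
    by_contra hne
    simp [hne] at h
  rw [← e]
  group

/-! ### The weak order -/

/-- The weak right Bruhat order. -/
def WeakLE (x w : W) : Prop := cs.length w = cs.length x + cs.length (x⁻¹ * w)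

variable {cs}

theorem WeakLE.refl (x : W) : cs.WeakLE x x := by simp [WeakLE]

theorem WeakLE.trans {x y z : W} (hxy : cs.WeakLE x y) (hyz : cs.WeakLE y z) :
    cs.WeakLE x z := by
  unfold WeakLE at *
  have h₁ := cs.length_mul_le x (x⁻¹ * z)
  have h₂ := cs.length_mul_le (x⁻¹ * y) (y⁻¹ * z)
  rw [mul_inv_cancel_left] at h₁
  rw [show x⁻¹ * y * (y⁻¹ * z) = x⁻¹ * z by group] at h₂
  omega

theorem WeakLE.length_mul {x w u : W} (hx : cs.WeakLE x w) (hu : cs.WeakLE u (x⁻¹ * w)) :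
    cs.length (x * u) = cs.length x + cs.length u := by
  unfold WeakLE at *
  have h₁ := cs.length_mul_le (x * u) ((x * u)⁻¹ * w)
  have h₂ := cs.length_mul_le x u
  rw [mul_inv_cancel_left, mul_inv_rev, mul_assoc] at h₁
  omega

theorem WeakLE.mul {x w u : W} (hx : cs.WeakLE x w) (hu : cs.WeakLE u (x⁻¹ * w)) :
    cs.WeakLE (x * u) w := by
  have h := hx.length_mul hu
  unfold WeakLE at *
  rw [mul_inv_rev, mul_assoc]
  omega

theorem weakLE_mul_mul {x u v : W} (h : cs.WeakLE u v)
    (hv : cs.length (x * v) = cs.length x + cs.length v) : cs.WeakLE (x * u) (x * v) := by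
  have hx : cs.WeakLE x (x * v) := by simpa [WeakLE] using hv
  exact hx.mul (by simpa using h)

theorem WeakLE.of_mul {x w u : W} (hx : cs.WeakLE x w)
    (hu : cs.length (x * u) = cs.length x + cs.length u) (h : cs.WeakLE (x * u) w) :
    cs.WeakLE u (x⁻¹ * w) := by
  unfold WeakLE at *
  rw [mul_inv_rev, mul_assoc] at h
  omega

theorem weakLE_simple_iff {i : B} {w : W} :
    cs.WeakLE (cs.simple i) w ↔ cs.IsLeftDescent w i := by
  rw [isLeftDescent_iff, WeakLE, length_simple, inv_simple, add_comm, eq_comm]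

theorem WeakLE.eq_of_length_le {x y : W} (h : cs.WeakLE x y) (hl : cs.length y ≤ cs.length x) :
    x = y := by
  unfold WeakLE at h
  exact inv_mul_eq_one.mp (cs.length_eq_zero_iff.mp (by omega))

theorem WeakLE.exists_simple {x y : W} (h : cs.WeakLE x y) (hne : x ≠ y) :
    ∃ i, cs.length (x * cs.simple i) = cs.length x + 1 ∧ cs.WeakLE (x * cs.simple i) y := by
  obtain ⟨i, hi⟩ := cs.exists_leftDescent_of_ne_one (mt inv_mul_eq_one.mp hne)
  rw [← weakLE_simple_iff] at hi
  exact ⟨i, by simpa using h.length_mul hi, h.mul hi⟩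

/-! ### Joins of two simple reflections -/

variable (cs)

/-- The alternating product `s i * s j * s i * ⋯` with `k` factors. -/
noncomputable def alternatingProd : B → B → ℕ → W
  | _, _, 0 => 1
  | i, j, k + 1 => cs.simple i * alternatingProd j i k

theorem alternatingProd_succ (i j : B) (k : ℕ) :
    cs.alternatingProd i j (k + 1) = cs.simple i * cs.alternatingProd j i k := rfl

theorem exists_alternatingProd_succ_eq_mul_simple (i j : B) (k : ℕ) :
    ∃ l, cs.alternatingProd i j (k + 1) = cs.alternatingProd i j k * cs.simple l := by
  induction k generalizing i j with
  | zero => exact ⟨i, by simp [alternatingProd]⟩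
  | succ k ih =>
    obtain ⟨l, hl⟩ := ih j i
    exact ⟨l, by rw [alternatingProd_succ, hl, alternatingProd_succ, mul_assoc]⟩

theorem length_alternatingProd_add_le (i j : B) (k n : ℕ) :
    cs.length (cs.alternatingProd i j (k + n)) ≤ cs.length (cs.alternatingProd i j k) + n := by
  induction n with
  | zero => simp
  | succ n ih =>
    obtain ⟨l, hl⟩ := cs.exists_alternatingProd_succ_eq_mul_simple i j (k + n)
    have := cs.length_mul_le (cs.alternatingProd i j (k + n)) (cs.simple l)
    rw [length_simple] at this
    rw [← add_assoc, hl]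
    omega

theorem length_alternatingProd_le (i j : B) (k : ℕ) :
    cs.length (cs.alternatingProd i j k) ≤ k := by
  simpa [alternatingProd] using cs.length_alternatingProd_add_le i j 0 k

theorem le_of_alternatingProd_eq {i j : B} {k k' : ℕ} (hk : 0 < k)
    (h : cs.alternatingProd i j k = cs.alternatingProd j i k)
    (hk' : cs.length (cs.alternatingProd i j k') = k') : k' ≤ k := by
  by_contra! hlt
  obtain ⟨n, rfl⟩ := Nat.exists_eq_add_of_le (Nat.succ_le_of_lt hlt)
  obtain ⟨k, rfl⟩ := Nat.exists_eq_add_of_le' hk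
  have h₁ := cs.length_alternatingProd_add_le i j (k + 1 + 1) n
  have h₂ := cs.length_alternatingProd_le j i k
  rw [alternatingProd_succ cs i j (k + 1), ← h, alternatingProd_succ cs i j k,
    simple_mul_simple_cancel_left] at h₁
  simp only [Nat.succ_eq_add_one] at hk'
  omega

variable {cs}

theorem weakLE_alternatingProd_succ {i j : B} {k : ℕ} {w : W} (hj : cs.IsLeftDescent w j)
    (hij : cs.WeakLE (cs.alternatingProd i j (k + 1)) w)
    (hl : cs.length (cs.alternatingProd i j (k + 1)) = k + 1)
    (hl' : cs.length (cs.alternatingProd j i (k + 1)) = k + 1) :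
    cs.alternatingProd i j (k + 1) = cs.alternatingProd j i (k + 1) ∨
      (cs.WeakLE (cs.alternatingProd j i (k + 2)) w ∧
        cs.length (cs.alternatingProd j i (k + 2)) = k + 2) := by
  set a := cs.alternatingProd i j (k + 1) with ha
  have hw : a * (a⁻¹ * w) = w := by group
  have hsucc : cs.alternatingProd j i (k + 2) = cs.simple j * a := rfl
  rcases IsReflection.length_mul_lt_or cs (cs.isReflection_simple j) a (a⁻¹ * w)
    (by rw [hw]; exact hj) with h | h
  · left
    obtain ⟨l, hl₂⟩ := cs.exists_alternatingProd_succ_eq_mul_simple i j k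
    rw [← ha] at hl₂
    rw [hl₂] at h ⊢
    refine (cs.simple_mul_eq_mul_simple _ j l ?_ h).symm
    have := cs.length_alternatingProd_le i j k
    rw [alternatingProd_succ] at hl'
    omega
  · right
    have e : a⁻¹ * cs.simple j * a * (a⁻¹ * w) = (cs.simple j * a)⁻¹ * w := by
      simp [mul_assoc]
    rw [e] at h
    have h₁ := cs.length_mul_le (cs.simple j * a) ((cs.simple j * a)⁻¹ * w)
    have h₂ := cs.length_alternatingProd_le j i (k + 2)
    rw [mul_inv_cancel_left] at h₁
    rw [hsucc] at h₂ ⊢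
    unfold WeakLE at *
    omega

theorem exists_alternatingProd_eq {i j : B} {w : W} (hi : cs.IsLeftDescent w i)
    (hj : cs.IsLeftDescent w j) :
    ∃ k, 0 < k ∧ cs.alternatingProd i j k = cs.alternatingProd j i k ∧
      cs.length (cs.alternatingProd i j k) = k ∧ cs.WeakLE (cs.alternatingProd i j k) w := by
  by_contra! hcon
  have key : ∀ k, (cs.WeakLE (cs.alternatingProd i j (k + 1)) w ∧
      cs.length (cs.alternatingProd i j (k + 1)) = k + 1) ∧
      (cs.WeakLE (cs.alternatingProd j i (k + 1)) w ∧
      cs.length (cs.alternatingProd j i (k + 1)) = k + 1) := by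
    intro k
    induction k with
    | zero => simp [alternatingProd, weakLE_simple_iff, hi, hj]
    | succ k ih =>
      obtain ⟨⟨h₁, l₁⟩, h₂, l₂⟩ := ih
      have hne : cs.alternatingProd i j (k + 1) ≠ cs.alternatingProd j i (k + 1) :=
        fun he ↦ hcon (k + 1) k.succ_pos he l₁ h₁
      exact ⟨(weakLE_alternatingProd_succ hi h₂ l₂ l₁).resolve_left hne.symm,
        (weakLE_alternatingProd_succ hj h₁ l₁ l₂).resolve_left hne⟩
  obtain ⟨⟨h, l⟩, -⟩ := key (cs.length w)
  unfold WeakLE at h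
  omega

/-- Two simple reflections with a common upper bound have a common upper bound lying below all
their common upper bounds. -/
theorem exists_weakLE_of_isLeftDescent {i j : B} {T : Set W} (hT : T.Nonempty)
    (hi : ∀ w ∈ T, cs.IsLeftDescent w i) (hj : ∀ w ∈ T, cs.IsLeftDescent w j) :
    ∃ u, cs.WeakLE (cs.simple i) u ∧ cs.WeakLE (cs.simple j) u ∧ ∀ w ∈ T, cs.WeakLE u w := by
  obtain ⟨w₀, hw₀⟩ := hT
  obtain ⟨k, hk, he, hl, -⟩ := exists_alternatingProd_eq (hi w₀ hw₀) (hj w₀ hw₀)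
  refine ⟨cs.alternatingProd i j k, ?_, ?_, fun w hw ↦ ?_⟩
  · obtain ⟨k, rfl⟩ := Nat.exists_eq_add_of_le' hk
    have := cs.length_alternatingProd_le j i k
    rw [weakLE_simple_iff, IsLeftDescent, hl, alternatingProd_succ, simple_mul_simple_cancel_left]
    omega
  · obtain ⟨k, rfl⟩ := Nat.exists_eq_add_of_le' hk
    have := cs.length_alternatingProd_le i j k
    rw [weakLE_simple_iff, IsLeftDescent, hl, he, alternatingProd_succ,
      simple_mul_simple_cancel_left]
    omega
  · obtain ⟨k', hk', he', hl', hw'⟩ := exists_alternatingProd_eq (hi w hw) (hj w hw)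
    rwa [le_antisymm (cs.le_of_alternatingProd_eq hk' he' hl)
      (cs.le_of_alternatingProd_eq hk he hl')]

/-! ### Lower bounds are directed -/

theorem exists_upper_bound_of_covers {T : Set W} (hT : T.Nonempty) {x : W} {i j : B}
    (hx : ∀ w ∈ T, cs.WeakLE x w)
    (hli : cs.length (x * cs.simple i) = cs.length x + 1)
    (hlj : cs.length (x * cs.simple j) = cs.length x + 1)
    (hi : ∀ w ∈ T, cs.WeakLE (x * cs.simple i) w)
    (hj : ∀ w ∈ T, cs.WeakLE (x * cs.simple j) w) :
    ∃ u, cs.WeakLE (x * cs.simple i) u ∧ cs.WeakLE (x * cs.simple j) u ∧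
      ∀ w ∈ T, cs.WeakLE u w := by
  obtain ⟨u, hiu, hju, hu⟩ := exists_weakLE_of_isLeftDescent (cs := cs) (i := i) (j := j)
    (hT.image (x⁻¹ * ·))
    (Set.forall_mem_image.2 fun w hw ↦
      weakLE_simple_iff.1 ((hx w hw).of_mul (by simpa using hli) (hi w hw)))
    (Set.forall_mem_image.2 fun w hw ↦
      weakLE_simple_iff.1 ((hx w hw).of_mul (by simpa using hlj) (hj w hw)))
  rw [Set.forall_mem_image] at hu
  obtain ⟨w₀, hw₀⟩ := hT
  have hxu := (hx w₀ hw₀).length_mul (hu hw₀)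
  exact ⟨x * u, weakLE_mul_mul hiu hxu, weakLE_mul_mul hju hxu, fun w hw ↦ (hx w hw).mul (hu hw)⟩

theorem exists_upper_bound_of_lower_bounds {T : Set W} {w₀ : W} (hw₀ : w₀ ∈ T) (x y z : W)
    (hx : ∀ w ∈ T, cs.WeakLE x w) (hy : ∀ w ∈ T, cs.WeakLE y w)
    (hz : ∀ w ∈ T, cs.WeakLE z w) (hxy : cs.WeakLE x y) (hxz : cs.WeakLE x z) :
    ∃ u, cs.WeakLE y u ∧ cs.WeakLE z u ∧ ∀ w ∈ T, cs.WeakLE u w := by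
  by_cases hyx : x = y
  · exact ⟨z, hyx ▸ hxz, .refl z, hz⟩
  by_cases hzx : x = z
  · exact ⟨y, .refl y, hzx ▸ hxy, hy⟩
  obtain ⟨i, hli, hiy⟩ := hxy.exists_simple hyx
  obtain ⟨j, hlj, hjz⟩ := hxz.exists_simple hzx
  have hi : ∀ w ∈ T, cs.WeakLE (x * cs.simple i) w := fun w hw ↦ hiy.trans (hy w hw)
  have hj : ∀ w ∈ T, cs.WeakLE (x * cs.simple j) w := fun w hw ↦ hjz.trans (hz w hw)
  obtain ⟨u, hiu, hju, hu⟩ := exists_upper_bound_of_covers ⟨w₀, hw₀⟩ hx hli hlj hi hj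
  have hbi : cs.length w₀ = _ := hi w₀ hw₀
  have hbj : cs.length w₀ = _ := hj w₀ hw₀
  obtain ⟨v, hyv, huv, hv⟩ := exists_upper_bound_of_lower_bounds hw₀ _ y u hi hy hu hiy hiu
  obtain ⟨t, hvt, hzt, ht⟩ :=
    exists_upper_bound_of_lower_bounds hw₀ _ v z hj hv hz (hju.trans huv) hjz
  exact ⟨t, hyv.trans hvt, hzt, ht⟩
termination_by cs.length w₀ - cs.length x

end CoxeterSystem


/-- The weak right Bruhat order (`v ≤ w ↔ ℓ(w) = ℓ(v) + ℓ(v⁻¹w)`) makes a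
Coxeter group into a complete meet-semilattice: every nonempty subset has a
greatest lower bound. -/
theorem coxeter_weakOrder_complete_meet_semilattice
    {B : Type*} {W : Type*} [Group W] {M : CoxeterMatrix B}
    (cs : CoxeterSystem M W) (T : Set W) (hT : T.Nonempty) :
    ∃ m : W,
      (∀ w ∈ T, cs.length w = cs.length m + cs.length (m⁻¹ * w)) ∧
      (∀ x : W, (∀ w ∈ T, cs.length w = cs.length x + cs.length (x⁻¹ * w)) →
        cs.length m = cs.length x + cs.length (x⁻¹ * m)) := by
  change ∃ m, (∀ w ∈ T, cs.WeakLE m w) ∧ ∀ x, (∀ w ∈ T, cs.WeakLE x w) → cs.WeakLE x m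
  obtain ⟨w₀, hw₀⟩ := hT
  have h_one (w : W) : cs.WeakLE 1 w := by simp [CoxeterSystem.WeakLE]
  let E : Set W := {x | ∀ w ∈ T, cs.WeakLE x w}
  have h_bdd : BddAbove (Set.image cs.length E) :=
    ⟨cs.length w₀, Set.forall_mem_image.2 fun x hx ↦
      (Nat.le_add_right _ _).trans_eq (hx w₀ hw₀).symm⟩
  have h_ne : E.Nonempty := ⟨1, fun w _ ↦ h_one w⟩
  obtain ⟨m, hm, hmax⟩ := Nat.sSup_mem (h_ne.image cs.length) h_bdd
  refine ⟨m, hm, fun x hx ↦ ?_⟩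
  obtain ⟨u, hmu, hxu, hu⟩ := CoxeterSystem.exists_upper_bound_of_lower_bounds hw₀ 1 m x
    (fun w _ ↦ h_one w) hm hx (h_one m) (h_one x)
  have h_le : cs.length u ≤ cs.length m := hmax ▸ le_csSup h_bdd ⟨u, hu, rfl⟩
  rwa [hmu.eq_of_length_le h_le]
end

section
/- Let (W,S) be an irreducible right-angled Coxeter system of finite rank that is not a free product of finite (special) Coxeter subgroups. Then there exist generators r,s,t ∈ S with m_{rs} = m_{rt} = 2 and m_{st} = ∞; consequently the centralizer C_W(r) contains a subgroup isomorphic to the infinite dihedral group, and hence is infinite. -/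
namespace DihedralGroup

/-- The homomorphism from the infinite dihedral group determined by two involutions. -/
def liftInvolutions {G : Type*} [Group G] (a b : G) (ha : a * a = 1) (hb : b * b = 1) :
    DihedralGroup 0 →* G :=
  have conj (n : ℤ) : a * (a * b) ^ n * a = (a * b) ^ (-n) := by
    have ha' : a⁻¹ = a := inv_eq_of_mul_eq_one_left ha
    have hb' : b⁻¹ = b := inv_eq_of_mul_eq_one_left hb
    have h : a * (a * b) * a⁻¹ = (a * b)⁻¹ := by
      rw [mul_inv_rev, ha', hb', ← mul_assoc, ha, one_mul]
    calc a * (a * b) ^ n * a = a * (a * b) ^ n * a⁻¹ := by rw [ha']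
      _ = (a * (a * b) * a⁻¹) ^ n := conj_zpow.symm
      _ = (a * b) ^ (-n) := by rw [h, inv_zpow, zpow_neg]
  MonoidHom.mk'
    (fun x => match x with
      | r i => (a * b) ^ (show ℤ from i)
      | sr i => a * (a * b) ^ (show ℤ from i))
    (by
      rintro (i | i) (j | j)
      · exact zpow_add (a * b) (show ℤ from i) (show ℤ from j)
      · change a * (a * b) ^ ((show ℤ from j) - (show ℤ from i)) =
          (a * b) ^ (show ℤ from i) * (a * (a * b) ^ (show ℤ from j))
        have h := conj (show ℤ from i)
        have h' : (a * b) ^ (show ℤ from i) * a = a * (a * b) ^ (-(show ℤ from i)) := by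
          rw [← h, ← mul_assoc, ← mul_assoc, ha, one_mul]
        rw [← mul_assoc, h', mul_assoc, ← zpow_add, sub_eq_neg_add]
      · change a * (a * b) ^ ((show ℤ from i) + (show ℤ from j)) =
          a * (a * b) ^ (show ℤ from i) * (a * b) ^ (show ℤ from j)
        rw [zpow_add, mul_assoc]
      · change (a * b) ^ ((show ℤ from j) - (show ℤ from i)) =
          a * (a * b) ^ (show ℤ from i) * (a * (a * b) ^ (show ℤ from j))
        rw [← mul_assoc, conj, ← zpow_add, sub_eq_neg_add])

section

variable {G : Type*} [Group G] {a b : G} (ha : a * a = 1) (hb : b * b = 1)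

theorem liftInvolutions_r (i : ℤ) :
    liftInvolutions a b ha hb (r (show ZMod 0 from i)) = (a * b) ^ i := rfl

theorem liftInvolutions_sr (i : ℤ) :
    liftInvolutions a b ha hb (sr (show ZMod 0 from i)) = a * (a * b) ^ i := rfl

theorem commute_liftInvolutions {c : G} (hac : Commute a c) (hbc : Commute b c)
    (x : DihedralGroup 0) : Commute (liftInvolutions a b ha hb x) c := by
  rcases x with i | i
  · exact (hac.mul_left hbc).zpow_left _
  · exact hac.mul_left ((hac.mul_left hbc).zpow_left _)

theorem liftInvolutions_injective (ψ : G →* DihedralGroup 0)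
    (hψa : ψ a = sr 0) (hψb : ψ b = sr 1) :
    Function.Injective (liftInvolutions a b ha hb) := by
  refine Function.LeftInverse.injective (g := ψ) fun x => ?_
  have hab (n : ℤ) : ψ ((a * b) ^ n) = r (show ZMod 0 from n) := by
    rw [map_zpow, map_mul, hψa, hψb, sr_mul_sr, sub_zero, r_one_zpow]
    rfl
  rcases x with i | i
  · exact hab i
  · refine (map_mul ψ a _).trans ?_
    rw [hab, hψa, sr_mul_r, zero_add]

end

end DihedralGroup

namespace CoxeterSystem

variable {B W : Type*} [Group W] {M : CoxeterMatrix B}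

/-- Two generators of a right-angled Coxeter system which do not commute are separated by a
retraction onto the infinite dihedral group. -/
theorem exists_hom_dihedralGroup (cs : CoxeterSystem M W)
    (hra : ∀ i j : B, i ≠ j → M.M i j = 2 ∨ M.M i j = 0)
    {s t : B} (hst : s ≠ t) (h : M.M s t = 0) :
    ∃ ψ : W →* DihedralGroup 0,
      ψ (cs.simple s) = DihedralGroup.sr 0 ∧ ψ (cs.simple t) = DihedralGroup.sr 1 := by
  classical
  let f : B → DihedralGroup 0 :=
    fun i => if i = s then .sr 0 else if i = t then .sr 1 else 1
  have hf : ∀ i, f i * f i = 1 := by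
    intro i
    dsimp only [f]
    split_ifs <;> simp
  have hlift : M.IsLiftable f := by
    intro i j
    change (f i * f j) ^ M.M i j = 1
    by_cases hij : i = j
    · rw [hij, hf, one_pow]
    rcases hra i j hij with h2 | h0
    · have hone : f i = 1 ∨ f j = 1 := by
        by_contra! hne
        have hmem : ∀ k, f k ≠ 1 → k = s ∨ k = t := by
          intro k hk
          by_contra! hk'
          exact hk (by simp [f, hk'.1, hk'.2])
        have hts : M.M t s = 0 := (M.symmetric t s).trans h
        rcases hmem i hne.1 with rfl | rfl <;> rcases hmem j hne.2 with rfl | rfl <;> simp_all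
      rcases hone with h1 | h1 <;> rw [h2, h1, pow_two] <;> simp [hf]
    · rw [h0, pow_zero]
  refine ⟨cs.lift ⟨f, hlift⟩, ?_, ?_⟩
  · rw [cs.lift_apply_simple hlift]
    simp [f]
  · rw [cs.lift_apply_simple hlift]
    simp [f, hst.symm]

theorem commute_simple_of_eq_two (cs : CoxeterSystem M W) {i j : B} (h : M.M i j = 2) :
    Commute (cs.simple i) (cs.simple j) := by
  have hp : (cs.simple i * cs.simple j) ^ M.M i j = 1 := cs.simple_mul_simple_pow i j
  rw [h, pow_two] at hp
  have := eq_inv_of_mul_eq_one_left hp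
  rwa [mul_inv_rev, cs.inv_simple, cs.inv_simple] at this

end CoxeterSystem

/-- If commutation of generators is not transitive, it fails to be so at some triple. -/
theorem CoxeterMatrix.exists_noncommuting_pair_of_not_setoid {B : Type*} (M : CoxeterMatrix B)
    (hnfp : ¬ ∃ r : Setoid B, ∀ i j : B, i ≠ j → (r.r i j ↔ M.M i j = 2)) :
    ∃ r s t : B, r ≠ s ∧ r ≠ t ∧ s ≠ t ∧ M.M r s = 2 ∧ M.M r t = 2 ∧ M.M s t ≠ 2 := by
  by_contra! hcon
  have hsymm (i j : B) : M.M i j = M.M j i := M.symmetric i j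
  refine hnfp ⟨⟨fun i j => i = j ∨ M.M i j = 2, fun i => Or.inl rfl, ?_, ?_⟩, ?_⟩
  · rintro i j (rfl | h)
    · exact Or.inl rfl
    · exact Or.inr (hsymm j i ▸ h)
  · rintro i j k (rfl | hij) (rfl | hjk)
    · exact Or.inl rfl
    · exact Or.inr hjk
    · exact Or.inr hij
    · by_cases hik : i = k
      · exact Or.inl hik
      have hne {x y : B} (h : M.M x y = 2) : x ≠ y := by
        rintro rfl
        have h1 : M.M x x = 1 := M.diagonal x
        omega
      exact Or.inr (hcon j i k (hne hij).symm (hne hjk) hik (hsymm j i ▸ hij) hjk)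
  · intro i j hij
    exact or_iff_right hij


/-- Let `(W,S)` be an irreducible right-angled Coxeter system of finite rank
(irreducible: the Coxeter diagram, with an edge between distinct `i, j`
whenever `m_{ij} ≠ 2`, is connected) which is not a free product of finite
special Coxeter subgroups (i.e. there is no partition of `S` such that two
distinct generators commute iff they lie in the same block). Then there are
generators `r, s, t` with `m_{rs} = m_{rt} = 2` and `m_{st} = ∞` (encoded `0`),
and consequently the centralizer of `s_r` contains a subgroup isomorphic to the
infinite dihedral group, and hence is infinite. -/
theorem rightAngled_irreducible_not_freeProduct_infinite_centralizer
    {B : Type*} [Finite B] {W : Type*} [Group W]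
    {M : CoxeterMatrix B} (cs : CoxeterSystem M W)
    (hra : ∀ i j : B, i ≠ j → M.M i j = 2 ∨ M.M i j = 0)
    (hirr : (SimpleGraph.fromRel (fun i j => M.M i j ≠ 2)).Connected)
    (hnfp : ¬ ∃ r : Setoid B, ∀ i j : B, i ≠ j → (r.r i j ↔ M.M i j = 2)) :
    ∃ r s t : B, r ≠ s ∧ r ≠ t ∧ s ≠ t ∧
      M.M r s = 2 ∧ M.M r t = 2 ∧ M.M s t = 0 ∧
      (∃ φ : DihedralGroup 0 →* W, Function.Injective φ ∧
        ∀ x, φ x ∈ Subgroup.centralizer {cs.simple r}) ∧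
      {w : W | w * cs.simple r = cs.simple r * w}.Infinite := by
  obtain ⟨r, s, t, hrs, hrt, hst, h1, h2, h3⟩ := M.exists_noncommuting_pair_of_not_setoid hnfp
  have h0 : M.M s t = 0 := (hra s t hst).resolve_left h3
  obtain ⟨ψ, hψs, hψt⟩ := cs.exists_hom_dihedralGroup hra hst h0
  let φ := DihedralGroup.liftInvolutions (cs.simple s) (cs.simple t)
    (cs.simple_mul_simple_self s) (cs.simple_mul_simple_self t)
  have hφ : Function.Injective φ := DihedralGroup.liftInvolutions_injective _ _ ψ hψs hψt
  have hcomm (x) : Commute (φ x) (cs.simple r) :=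
    DihedralGroup.commute_liftInvolutions _ _ (cs.commute_simple_of_eq_two h1).symm
      (cs.commute_simple_of_eq_two h2).symm x
  refine ⟨r, s, t, hrs, hrt, hst, h1, h2, h0, ⟨φ, hφ, fun x => ?_⟩, ?_⟩
  · exact Subgroup.mem_centralizer_singleton_iff.mpr (hcomm x)
  · have : Infinite (DihedralGroup 0) := inferInstance
    exact (Set.infinite_range_of_injective hφ).mono (Set.range_subset_iff.mpr hcomm)
end
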